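/- arXiv:2503.09745 — 2 statements merged into one kernel-verified Lean document; each statement's English description precedes it below -/
import Mathlib

section
/- Let X be a topological space, f : X → X a continuous map, U₁, U₂ ⊆ X open sets with U₁ ∩ U₂ = ∅, and B ⊆ X a set with f(U₁) ⊆ U₁ ∪ B, f(U₂) ⊆ U₂ ∪ B, f(B) ⊆ B, and B ∩ (U₁ ∪ U₂) = ∅. Let K ⊆ X be a subset such that for every x ∈ K there exists an integer n ≥ 1 with fⁿ(x) ∈ U₁ ∪ U₂, and for x ∈ K let k_x denote the least such n. Then the function φ : K → {0,1} defined by φ(x) = 0 if f^{k_x}(x) ∈ U₁ and φ(x) = 1 if f^{k_x}(x) ∈ U₂ is continuous, where K carries the subspace topology and {0,1} the discrete topology. -/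
/-- If `V` is forward invariant and disjoint from `U`, an orbit that is in `U` at time `n`
avoids `V` at all earlier times. -/
theorem Set.MapsTo.iterate_notMem_of_le {X : Type*} {f : X → X} {U V : Set X}
    (hV : Set.MapsTo f V V) (hUV : Disjoint U V) {y : X} {m n : ℕ} (hmn : m ≤ n)
    (hy : f^[n] y ∈ U) : f^[m] y ∉ V := by
  intro hm
  refine Set.disjoint_left.mp hUV hy ?_
  obtain ⟨d, rfl⟩ := Nat.exists_eq_add_of_le' hmn
  rw [Function.iterate_add_apply]
  exact hV.iterate d hm

theorem Set.MapsTo.union_of_image_subset {X : Type*} {f : X → X} {U B : Set X}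
    (hU : f '' U ⊆ U ∪ B) (hB : f '' B ⊆ B) : Set.MapsTo f (U ∪ B) (U ∪ B) := by
  rw [Set.mapsTo_iff_image_subset, Set.image_union]
  exact Set.union_subset hU (hB.trans Set.subset_union_right)

/-- **Continuity of the first-hit labeling function.**
Let `f : X → X` be continuous, `U₁, U₂` disjoint open sets, and `B` a set with
`f(U₁) ⊆ U₁ ∪ B`, `f(U₂) ⊆ U₂ ∪ B`, `f(B) ⊆ B`, `B ∩ (U₁ ∪ U₂) = ∅`.
Let `K ⊆ X` be such that every point of `K` enters `U₁ ∪ U₂` under some iterate `fⁿ`, `n ≥ 1`,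
and let `k x` be the least such `n`.  The function `φ : K → Bool` (with `Bool` carrying
the discrete topology) sending `x` to `false` if `f^[k x] x ∈ U₁` and to `true` if
`f^[k x] x ∈ U₂` is continuous on `K` with the subspace topology. -/
theorem stmt2 {X : Type*} [TopologicalSpace X] (f : X → X) (hf : Continuous f)
    (U₁ U₂ : Set X) (hU₁open : IsOpen U₁) (hU₂open : IsOpen U₂) (hU₁U₂ : U₁ ∩ U₂ = ∅)
    (B : Set X) (hfU₁ : f '' U₁ ⊆ U₁ ∪ B) (hfU₂ : f '' U₂ ⊆ U₂ ∪ B)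
    (hfB : f '' B ⊆ B) (hB : B ∩ (U₁ ∪ U₂) = ∅)
    (K : Set X)
    (k : K → ℕ)
    (hk1 : ∀ x : K, 1 ≤ k x)
    (hkmem : ∀ x : K, f^[k x] (x : X) ∈ U₁ ∪ U₂)
    (hkmin : ∀ x : K, ∀ m : ℕ, 1 ≤ m → m < k x → f^[m] (x : X) ∉ U₁ ∪ U₂)
    (φ : K → Bool)
    (hφ₁ : ∀ x : K, f^[k x] (x : X) ∈ U₁ → φ x = false)
    (hφ₂ : ∀ x : K, f^[k x] (x : X) ∈ U₂ → φ x = true) :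
    Continuous φ := by
  have hdisj := Set.disjoint_iff_inter_eq_empty.mpr hU₁U₂
  obtain ⟨hBU₁, hBU₂⟩ := Set.disjoint_union_right.mp (Set.disjoint_iff_inter_eq_empty.mpr hB)
  have hle (y : K) {n : ℕ} (hn : 1 ≤ n) (hy : f^[n] (y : X) ∈ U₁ ∪ U₂) : k y ≤ n :=
    not_lt.mp fun h => hkmin y n hn h hy
  have hnhds (x : K) {U : Set X} (hU : IsOpen U) (hx : f^[k x] (x : X) ∈ U) :
      ∀ᶠ y : K in nhds x, f^[k x] (y : X) ∈ U :=
    ((hf.iterate (k x)).comp continuous_subtype_val).continuousAt.eventually_mem (hU.mem_nhds hx)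
  refine ((IsLocallyConstant.iff_eventually_eq φ).mpr fun x => ?_).continuous
  rcases hkmem x with hx | hx
  · filter_upwards [hnhds x hU₁open hx] with y hy
    have hnot := (Set.MapsTo.union_of_image_subset hfU₂ hfB).iterate_notMem_of_le
      (Set.disjoint_union_right.mpr ⟨hdisj, hBU₁.symm⟩) (hle y (hk1 x) (Or.inl hy)) hy
    rw [hφ₁ x hx, hφ₁ y ((hkmem y).resolve_right fun h => hnot (Or.inl h))]
  · filter_upwards [hnhds x hU₂open hx] with y hy
    have hnot := (Set.MapsTo.union_of_image_subset hfU₁ hfB).iterate_notMem_of_le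
      (Set.disjoint_union_right.mpr ⟨hdisj.symm, hBU₂.symm⟩) (hle y (hk1 x) (Or.inr hy)) hy
    rw [hφ₂ x hx, hφ₂ y ((hkmem y).resolve_left fun h => hnot (Or.inl h))]
end

section
/- Let (X,d) be a compact metric space, f : X → X a homeomorphism, p, q ∈ X with f(p) = p and f(q) = q, and γ₁, γ₂ : ℝ → X continuous curves with f(γᵢ(t)) = γᵢ(t+1) for all t ∈ ℝ, γᵢ(t) → q as t → +∞, and γᵢ(t) → p as t → −∞ (i = 1,2). Then for every δ > 0 there exists M > 0 such that the bi-infinite sequence (Xₙ)_{n∈ℤ} of subsets of X defined by X₀ := γ₁(ℝ) ∪ γ₂(ℝ) ∪ {p,q}, X₁ := γ₁([−M,∞)) ∪ γ₂([−M,∞)) ∪ {q}, X₋₁ := γ₁((−∞,M]) ∪ γ₂((−∞,M]) ∪ {p}, Xₙ := f^{n−1}(X₁) for n ≥ 1, and Xₙ := f^{n+1}(X₋₁) for n ≤ −1, satisfies d_H(f(Xₙ), X_{n+1}) < δ for every n ∈ ℤ. -/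
open Set Metric Filter

/-- If `B ⊆ A` meets the closed ball of radius `ε` about `c`, and `A \ B` lies in that ball, then the
Hausdorff distance of `A` and `B` is at most `2 * ε`. -/
theorem hausdorffDist_le_two_mul_of_diff_subset_closedBall {X : Type*} [PseudoMetricSpace X]
    {A B : Set X} {b c : X} {ε : ℝ} (hBA : B ⊆ A) (hb : b ∈ B) (hbc : dist b c ≤ ε)
    (hA : ∀ x ∈ A, x ∈ B ∨ dist x c ≤ ε) : hausdorffDist A B ≤ 2 * ε := by
  have hε : 0 ≤ ε := dist_nonneg.trans hbc
  refine hausdorffDist_le_of_mem_dist (by positivity) (fun x hx => ?_)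
    fun x hx => ⟨x, hBA hx, by simpa using hε⟩
  rcases hA x hx with h | h
  · exact ⟨x, h, by simpa using hε⟩
  · exact ⟨b, hb, by linarith [dist_triangle_right x b c]⟩

/-- If `γ` semiconjugates translation by `1` to `f`, then `f` carries the image of `S`
to the image of the translate of `S`. -/
theorem image_image_eq_of_map_add_one {X : Type*} {f : X → X} {γ : ℝ → X}
    (h : ∀ t, f (γ t) = γ (t + 1)) (S : Set ℝ) : f '' (γ '' S) = γ '' ((· + 1) '' S) := by
  simp only [image_image, h]

/-- **Construction of the δ-pseudo-orbit on the hyperspace.**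
Let `X` be a compact metric space, `f : X ≃ₜ X` a homeomorphism with fixed points `p, q`,
and `γ₁, γ₂ : ℝ → X` continuous curves with `f (γᵢ t) = γᵢ (t+1)`, `γᵢ(t) → q` as
`t → +∞` and `γᵢ(t) → p` as `t → −∞`.  Then for every `δ > 0` there is `M > 0` such that
the bi-infinite sequence `Xₙ` of subsets of `X` given by
`X₀ := γ₁(ℝ) ∪ γ₂(ℝ) ∪ {p,q}`, `X₁ := γ₁([−M,∞)) ∪ γ₂([−M,∞)) ∪ {q}`,
`X₋₁ := γ₁((−∞,M]) ∪ γ₂((−∞,M]) ∪ {p}`, `X_{n+1} = f(Xₙ)` for `n ≥ 1` and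
`X_{n−1} = f⁻¹(Xₙ)` for `n ≤ −1`, satisfies `d_H(f(Xₙ), X_{n+1}) < δ` for all `n ∈ ℤ`. -/
theorem stmt7 {X : Type*} [MetricSpace X] [CompactSpace X]
    (f : X ≃ₜ X) (p q : X) (hp : f p = p) (hq : f q = q)
    (γ₁ γ₂ : ℝ → X) (hγ₁ : Continuous γ₁) (hγ₂ : Continuous γ₂)
    (hfγ₁ : ∀ t : ℝ, f (γ₁ t) = γ₁ (t + 1)) (hfγ₂ : ∀ t : ℝ, f (γ₂ t) = γ₂ (t + 1))
    (hγ₁q : Tendsto γ₁ atTop (nhds q)) (hγ₂q : Tendsto γ₂ atTop (nhds q))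
    (hγ₁p : Tendsto γ₁ atBot (nhds p)) (hγ₂p : Tendsto γ₂ atBot (nhds p)) :
    ∀ δ > 0, ∃ M > 0, ∀ Xs : ℤ → Set X,
      Xs 0 = γ₁ '' univ ∪ γ₂ '' univ ∪ {p, q} →
      Xs 1 = γ₁ '' Ici (-M) ∪ γ₂ '' Ici (-M) ∪ {q} →
      Xs (-1) = γ₁ '' Iic M ∪ γ₂ '' Iic M ∪ {p} →
      (∀ n : ℤ, 1 ≤ n → Xs (n + 1) = f '' Xs n) →
      (∀ n : ℤ, n ≤ -1 → Xs (n - 1) = f.symm '' Xs n) →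
      ∀ n : ℤ, hausdorffDist (f '' Xs n) (Xs (n + 1)) < δ := by
  intro δ hδ
  have hδ4 : 0 < δ / 4 := by positivity
  have htop : ∀ᶠ t in atTop, dist (γ₁ t) q ≤ δ / 4 ∧ dist (γ₂ t) q ≤ δ / 4 :=
    ((hγ₁q.eventually (closedBall_mem_nhds q hδ4)).and
    (hγ₂q.eventually (closedBall_mem_nhds q hδ4)))
  have hbot : ∀ᶠ t in atBot, dist (γ₁ t) p ≤ δ / 4 ∧ dist (γ₂ t) p ≤ δ / 4 :=
    ((hγ₁p.eventually (closedBall_mem_nhds p hδ4)).and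
    (hγ₂p.eventually (closedBall_mem_nhds p hδ4)))
  obtain ⟨a, ha⟩ := eventually_atTop.1 htop
  obtain ⟨b, hb⟩ := eventually_atBot.1 hbot
  refine ⟨max 1 (max a (-b)), by positivity, ?_⟩
  set M := max 1 (max a (-b))
  have haM : a ≤ M := (le_max_left _ _).trans (le_max_right _ _)
  have hbM : -b ≤ M := (le_max_right _ _).trans (le_max_right _ _)
  intro Xs h0 h1 hm1 hpos hneg n
  obtain hn | rfl | rfl | hn : 1 ≤ n ∨ n = 0 ∨ n = -1 ∨ n + 1 ≤ -1 := by omega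
  · rw [hpos n hn, hausdorffDist_self_zero]
    exact hδ
  · have hf0 : f '' Xs 0 = Xs 0 := by
      have hu : (fun t : ℝ => t + 1) '' univ = univ :=
        image_univ_of_surjective (add_right_surjective 1)
      rw [h0, image_union, image_union, image_image_eq_of_map_add_one hfγ₁,
        image_image_eq_of_map_add_one hfγ₂, hu, image_pair, hp, hq]
    rw [hf0, zero_add, h0, h1]
    refine (hausdorffDist_le_two_mul_of_diff_subset_closedBall (b := γ₁ (-M)) (c := p)
      (ε := δ / 4) ?_ ?_ (hb _ (by linarith)).1 ?_).trans_lt (by linarith)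
    · exact union_subset_union (union_subset_union (image_mono (subset_univ _))
        (image_mono (subset_univ _))) (by simp)
    · exact Or.inl (Or.inl ⟨-M, self_mem_Ici, rfl⟩)
    · rintro x ((⟨t, -, rfl⟩ | ⟨t, -, rfl⟩) | rfl | rfl)
      · rcases le_total (-M) t with h | h
        · exact Or.inl (Or.inl (Or.inl ⟨t, h, rfl⟩))
        · exact Or.inr (hb t (by linarith)).1
      · rcases le_total (-M) t with h | h
        · exact Or.inl (Or.inl (Or.inr ⟨t, h, rfl⟩))
        · exact Or.inr (hb t (by linarith)).2
      · exact Or.inr (by simpa using hδ4.le)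
      · exact Or.inl (Or.inr rfl)
  · have hfm : f '' Xs (-1) = γ₁ '' Iic (M + 1) ∪ γ₂ '' Iic (M + 1) ∪ {p} := by
      rw [hm1, image_union, image_union, image_image_eq_of_map_add_one hfγ₁,
        image_image_eq_of_map_add_one hfγ₂, image_add_const_Iic, image_singleton, hp]
    rw [hfm, neg_add_cancel, h0, hausdorffDist_comm]
    refine (hausdorffDist_le_two_mul_of_diff_subset_closedBall (b := γ₁ (M + 1)) (c := q)
      (ε := δ / 4) ?_ ?_ (ha _ (by linarith)).1 ?_).trans_lt (by linarith)
    · exact union_subset_union (union_subset_union (image_mono (subset_univ _))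
        (image_mono (subset_univ _))) (by simp)
    · exact Or.inl (Or.inl ⟨M + 1, self_mem_Iic, rfl⟩)
    · rintro x ((⟨t, -, rfl⟩ | ⟨t, -, rfl⟩) | rfl | rfl)
      · rcases le_total t (M + 1) with h | h
        · exact Or.inl (Or.inl (Or.inl ⟨t, h, rfl⟩))
        · exact Or.inr (ha t (by linarith)).1
      · rcases le_total t (M + 1) with h | h
        · exact Or.inl (Or.inl (Or.inr ⟨t, h, rfl⟩))
        · exact Or.inr (ha t (by linarith)).2
      · exact Or.inl (Or.inr rfl)
      · exact Or.inr (by simpa using hδ4.le)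
  · have hstep := hneg (n + 1) hn
    rw [add_sub_cancel_right] at hstep
    rw [hstep, image_image]
    simpa using hδ
end
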